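/- Let 1 < p < ∞ with p ≠ 2. There is a constant c_p > 0 such that for every n ∈ ℕ there exist signs ε_k ∈ {−1, 1}, k = 1,…,n, such that the sequence a = (a_m)_{m∈ℤ} given by a_k = ε_k for 1 ≤ k ≤ n and a_m = 0 otherwise satisfies ‖a‖_{M^p(𝕋)} ≥ c_p · n^{|1/2 − 1/p|}. -/

import Mathlib

open MeasureTheory Real Filter Set
open scoped ENNReal Topology

noncomputable section

/-- The character `e2 m x = e^{2πimx}`. -/
def e2 (m : ℤ) (x : ℝ) : ℂ := Complex.exp (2 * π * Complex.I * m * x)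

/-- The `L^p([0,1])` norm of a function `g : ℝ → ℂ` (as a model for `L^p(𝕋)`). -/
def LpNorm01 (p : ℝ) (g : ℝ → ℂ) : ℝ :=
  (∫ x in Ioc (0:ℝ) 1, ‖g x‖ ^ p) ^ (1 / p)

/-- The `M^p(𝕋)` multiplier norm of a sequence `a : ℤ → ℂ`: the least constant `C ≥ 0`
such that for every trigonometric polynomial `f = ∑ c_m e^{2πimx}` (with finitely
supported coefficients `c`) one has `‖∑ a_m c_m e^{2πimx}‖_{L^p} ≤ C ‖f‖_{L^p}`.
By density of trigonometric polynomials, this is the operator norm of the Fourier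
multiplier `T_a` on `L^p(𝕋)`. -/
def multNormT (p : ℝ) (a : ℤ → ℂ) : ℝ :=
  sInf {C : ℝ | 0 ≤ C ∧ ∀ c : ℤ →₀ ℂ,
    LpNorm01 p (fun x => ∑ m ∈ c.support, a m * c m * e2 m x) ≤
      C * LpNorm01 p (fun x => ∑ m ∈ c.support, c m * e2 m x)}

lemma e2_cont (m : ℤ) : Continuous (e2 m) := by
  unfold e2; fun_prop

lemma e2_norm (m : ℤ) (x : ℝ) : ‖e2 m x‖ = 1 := by
  unfold e2
  rw [show (2 * π * Complex.I * m * x : ℂ) = ((2 * π * m * x : ℝ) : ℂ) * Complex.I by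
    push_cast; ring]
  exact Complex.norm_exp_ofReal_mul_I _

lemma e2_add (m k : ℤ) (x : ℝ) : e2 (m + k) x = e2 m x * e2 k x := by
  unfold e2
  rw [← Complex.exp_add]; congr 1; push_cast; ring

lemma e2_zero (x : ℝ) : e2 0 x = 1 := by simp [e2]

lemma e2_conj (m : ℤ) (x : ℝ) : (starRingEnd ℂ) (e2 m x) = e2 (-m) x := by
  unfold e2
  rw [← Complex.exp_conj]; congr 1
  simp [Complex.conj_ofReal, Complex.conj_ofNat]

lemma e2_integral (m : ℤ) : ∫ x in Ioc (0:ℝ) 1, e2 m x = if m = 0 then 1 else 0 := by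
  split_ifs with h
  · subst h; simp [e2_zero]
  · rw [← intervalIntegral.integral_of_le zero_le_one]
    have hc : (2 * π * Complex.I * m : ℂ) ≠ 0 := by
      simp [h, Real.pi_ne_zero]
    unfold e2
    rw [integral_exp_mul_complex hc]
    have : Complex.exp (2 * π * Complex.I * m * (1:ℝ)) = 1 := by
      rw [Complex.exp_eq_one_iff]; exact ⟨m, by push_cast; ring⟩
    rw [this]; simp

lemma cont_int {E : Type*} [NormedAddCommGroup E] {f : ℝ → E} (hf : Continuous f) :
    Integrable f (volume.restrict (Ioc (0:ℝ) 1)) :=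
  (hf.integrableOn_Icc (a := 0) (b := 1)).mono_set Ioc_subset_Icc_self

lemma poly_cont (S : Finset ℤ) (b : ℤ → ℂ) :
    Continuous (fun x => ∑ m ∈ S, b m * e2 m x) :=
  continuous_finsetSum _ fun m _ => continuous_const.mul (e2_cont m)

lemma coef_integral (S : Finset ℤ) (b : ℤ → ℂ) (k : ℤ) :
    ∫ x in Ioc (0:ℝ) 1, (∑ m ∈ S, b m * e2 m x) * e2 (-k) x = if k ∈ S then b k else 0 := by
  have h : ∀ x, (∑ m ∈ S, b m * e2 m x) * e2 (-k) x = ∑ m ∈ S, b m * e2 (m - k) x := by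
    intro x
    rw [Finset.sum_mul]
    refine Finset.sum_congr rfl fun m _ => ?_
    rw [sub_eq_add_neg, e2_add]; ring
  simp_rw [h]
  rw [integral_finsetSum S (f := fun m x => b m * e2 (m - k) x)
    fun m _ => cont_int (continuous_const.mul (e2_cont _))]
  simp_rw [integral_const_mul, e2_integral, sub_eq_zero]
  simp

lemma Lp_le_sup {p : ℝ} (hp : 1 < p) {f : ℝ → ℂ} (hf : Continuous f) {B : ℝ} (hB : 0 ≤ B)
    (h : ∀ x, ‖f x‖ ≤ B) : LpNorm01 p f ≤ B := by
  have hc : Continuous fun x => ‖f x‖ ^ p :=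
    hf.norm.rpow_const fun x => Or.inr (by linarith)
  have h1 : ∫ x in Ioc (0:ℝ) 1, ‖f x‖ ^ p ≤ B ^ p := by
    calc _ ≤ ∫ x in Ioc (0:ℝ) 1, B ^ p :=
          integral_mono (cont_int hc) (cont_int continuous_const) fun x =>
            Real.rpow_le_rpow (norm_nonneg _) (h x) (by linarith)
      _ = _ := by simp
  unfold LpNorm01
  calc _ ≤ (B ^ p) ^ (1 / p) := Real.rpow_le_rpow
          (integral_nonneg fun x => by positivity) h1 (by positivity)
    _ = B := by rw [one_div]; exact Real.rpow_rpow_inv hB (by linarith)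

lemma L1_le_Lp {p : ℝ} (hp : 1 < p) {f : ℝ → ℂ} (hf : Continuous f) :
    ∫ x in Ioc (0:ℝ) 1, ‖f x‖ ≤ LpNorm01 p f := by
  have hc : Continuous fun x => ‖f x‖ ^ p :=
    hf.norm.rpow_const fun x => Or.inr (by linarith)
  have : IsProbabilityMeasure (volume.restrict (Ioc (0:ℝ) 1)) := ⟨by simp⟩
  have h := (convexOn_rpow hp.le).map_integral_le (μ := volume.restrict (Ioc (0:ℝ) 1))
    (f := fun x => ‖f x‖)
    (by exact fun x hx => (Real.continuousAt_rpow_const _ _ (Or.inr (by linarith))).continuousWithinAt)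
    isClosed_Ici (Eventually.of_forall fun x => norm_nonneg _) (cont_int hf.norm) (cont_int hc)
  have h0 : 0 ≤ ∫ x in Ioc (0:ℝ) 1, ‖f x‖ := integral_nonneg fun x => norm_nonneg _
  unfold LpNorm01
  calc _ = ((∫ x in Ioc (0:ℝ) 1, ‖f x‖) ^ p) ^ (1 / p) := by
          rw [one_div, Real.rpow_rpow_inv h0 (by linarith)]
    _ ≤ _ := Real.rpow_le_rpow (by positivity) h (by positivity)

/-- Multipliers supported in `[1,n]` and bounded by one are bounded. -/
lemma mult_bdd {p : ℝ} (hp : 1 < p) (n : ℕ) (a : ℤ → ℂ) (ha : ∀ m, ‖a m‖ ≤ 1)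
    (ha0 : ∀ m, ¬ (1 ≤ m ∧ m ≤ (n : ℤ)) → a m = 0) (c : ℤ →₀ ℂ) :
    LpNorm01 p (fun x => ∑ m ∈ c.support, a m * c m * e2 m x) ≤
      n * LpNorm01 p (fun x => ∑ m ∈ c.support, c m * e2 m x) := by
  set L := LpNorm01 p (fun x => ∑ m ∈ c.support, c m * e2 m x) with hL
  have hcoef : ∀ k, ‖c k‖ ≤ L := by
    intro k
    have h := coef_integral c.support c k
    have h2 : (if k ∈ c.support then c k else 0) = c k := by
      split_ifs with h
      · rfl
      · simpa using (Finsupp.notMem_support_iff.1 h).symm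
    rw [h2] at h
    rw [← h]
    refine (norm_integral_le_integral_norm _).trans ?_
    simp_rw [norm_mul, e2_norm, mul_one]
    exact L1_le_Lp hp (poly_cont _ _)
  have hL0 : 0 ≤ L := (norm_nonneg _).trans (hcoef 0)
  refine Lp_le_sup hp (poly_cont c.support fun m => a m * c m) (by positivity) fun x => ?_
  calc ‖∑ m ∈ c.support, a m * c m * e2 m x‖ 
      = ‖∑ m ∈ c.support ∩ Finset.Icc 1 (n:ℤ), a m * c m * e2 m x‖ := by
        congr 1
        symm
        refine Finset.sum_subset Finset.inter_subset_left fun m hm hm' => ?_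
        rw [ha0 m]
        · simp
        · intro h; exact hm' (by simp [Finset.mem_inter] at *; exact ⟨hm, h⟩)
    _ ≤ ∑ m ∈ c.support ∩ Finset.Icc 1 (n:ℤ), L := by
        refine norm_sum_le_of_le _ fun m _ => ?_
        rw [norm_mul, norm_mul, e2_norm, mul_one]
        calc _ ≤ 1 * L := mul_le_mul (ha m) (hcoef m) (norm_nonneg _) zero_le_one
          _ = L := one_mul _
    _ ≤ n * L := by
        rw [Finset.sum_const, nsmul_eq_mul]
        gcongr
        calc _ ≤ (Finset.Icc 1 (n:ℤ)).card := Finset.card_le_card Finset.inter_subset_right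
          _ = n := by simp

/-- Lower bounds for the multiplier norm from a test function. -/
lemma mult_lower {p : ℝ} (hp : 1 < p) (n : ℕ) (a : ℤ → ℂ) (ha : ∀ m, ‖a m‖ ≤ 1)
    (ha0 : ∀ m, ¬ (1 ≤ m ∧ m ≤ (n : ℤ)) → a m = 0) (c : ℤ →₀ ℂ) {A b : ℝ} (hA : 0 < A)
    (h1 : LpNorm01 p (fun x => ∑ m ∈ c.support, c m * e2 m x) ≤ A)
    (h2 : b * A ≤ LpNorm01 p (fun x => ∑ m ∈ c.support, a m * c m * e2 m x)) :
    b ≤ multNormT p a := by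
  unfold multNormT
  refine le_csInf ⟨n, by positivity, mult_bdd hp n a ha ha0⟩ ?_
  rintro C ⟨hC, h⟩
  have := h c
  have h3 : b * A ≤ C * A := h2.trans (this.trans (by gcongr))
  exact le_of_mul_le_mul_right h3 hA

/-- Rudin–Shapiro polynomials. -/
lemma rudin_shapiro (k : ℕ) : ∃ ε δ : ℕ → ℝ, (∀ j, ε j = 1 ∨ ε j = -1) ∧
    (∀ j, δ j = 1 ∨ δ j = -1) ∧ ∀ x,
    ‖∑ j ∈ Finset.range (2 ^ k), (ε j : ℂ) * e2 (j + 1) x‖ ^ 2 +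
    ‖∑ j ∈ Finset.range (2 ^ k), (δ j : ℂ) * e2 (j + 1) x‖ ^ 2 = 2 * 2 ^ k := by
  induction k with
  | zero => 
    refine ⟨fun _ => 1, fun _ => 1, by simp, by simp, fun x => ?_⟩
    simp [e2_norm]; norm_num
  | succ k ih =>
    obtain ⟨ε, δ, h1, h2, h⟩ := ih
    refine ⟨fun j => if j < 2 ^ k then ε j else δ (j - 2 ^ k),
      fun j => if j < 2 ^ k then ε j else - δ (j - 2 ^ k), ?_, ?_, fun x => ?_⟩
    · intro j; dsimp only; split_ifs; exacts [h1 _, h2 _]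
    · intro j; dsimp only; split_ifs
      · exact h1 _
      · rcases h2 (j - 2 ^ k) with h | h <;> simp [h]
    · specialize h x
      set P := ∑ j ∈ Finset.range (2 ^ k), (ε j : ℂ) * e2 (j + 1) x
      set Q := ∑ j ∈ Finset.range (2 ^ k), (δ j : ℂ) * e2 (j + 1) x with hQ
      have e1 : ∑ j ∈ Finset.range (2 ^ (k+1)), 
          (((if j < 2 ^ k then ε j else δ (j - 2 ^ k)) : ℝ) : ℂ) * e2 (j + 1) x
          = P + e2 (2 ^ k) x * Q := by
        rw [pow_succ, mul_two, Finset.sum_range_add]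
        congr 1
        · refine Finset.sum_congr rfl fun j hj => ?_
          rw [if_pos (Finset.mem_range.1 hj)]
        · rw [hQ, Finset.mul_sum]
          refine Finset.sum_congr rfl fun j hj => ?_
          rw [if_neg (by omega), Nat.add_sub_cancel_left]
          push_cast
          rw [add_assoc, e2_add]; ring
      have e3 : ∑ j ∈ Finset.range (2 ^ (k+1)), 
          (((if j < 2 ^ k then ε j else - δ (j - 2 ^ k)) : ℝ) : ℂ) * e2 (j + 1) x
          = P - e2 (2 ^ k) x * Q := by
        rw [pow_succ, mul_two, Finset.sum_range_add, sub_eq_add_neg]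
        congr 1
        · refine Finset.sum_congr rfl fun j hj => ?_
          rw [if_pos (Finset.mem_range.1 hj)]
        · rw [hQ, Finset.mul_sum, ← Finset.sum_neg_distrib]
          refine Finset.sum_congr rfl fun j hj => ?_
          rw [if_neg (by omega), Nat.add_sub_cancel_left]
          push_cast
          rw [add_assoc, e2_add]; ring
      rw [e1, e3]
      have := parallelogram_law_with_norm ℝ P (e2 (2 ^ k) x * Q)
      rw [norm_mul, e2_norm, one_mul] at this
      rw [this, h, pow_succ]; ring

/-- A trigonometric polynomial as a linear combination of singletons. -/
lemma poly_single {ι : Type*} (s : Finset ι) (g : ι → ℤ) (w : ι → ℂ) (a : ℤ → ℂ) (x : ℝ) :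
    ∑ m ∈ (∑ i ∈ s, Finsupp.single (g i) (w i)).support,
      a m * (∑ i ∈ s, Finsupp.single (g i) (w i)) m * e2 m x
      = ∑ i ∈ s, a (g i) * w i * e2 (g i) x := by
  change Finsupp.sum (∑ i ∈ s, Finsupp.single (g i) (w i)) (fun m z => a m * z * e2 m x) = _
  rw [← Finsupp.sum_finsetSum_index (by simp) (by intros; ring)]
  refine Finset.sum_congr rfl fun i _ => ?_
  rw [Finsupp.sum_single_index (by simp)]

lemma poly_single' {ι : Type*} (s : Finset ι) (g : ι → ℤ) (w : ι → ℂ) (x : ℝ) :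
    ∑ m ∈ (∑ i ∈ s, Finsupp.single (g i) (w i)).support,
      (∑ i ∈ s, Finsupp.single (g i) (w i)) m * e2 m x
      = ∑ i ∈ s, w i * e2 (g i) x := by
  simpa using poly_single s g w (fun _ => 1) x

/-- The Dirichlet kernel is large near the origin. -/
lemma dirichlet_big {N : ℕ} (hN : 0 < N) {x : ℝ} (hx : x ∈ Ioc (0:ℝ) (1 / (8 * N))) :
    (N : ℝ) / 2 ≤ ‖∑ j ∈ Finset.range N, e2 (j + 1) x‖ := by
  refine le_trans ?_ (Complex.re_le_norm _)
  rw [Complex.re_sum]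
  have : ∀ j ∈ Finset.range N, (1:ℝ) / 2 ≤ (e2 (j + 1) x).re := by
    intro j hj
    have hj' : (j:ℝ) + 1 ≤ N := by exact_mod_cast Finset.mem_range.1 hj
    unfold e2
    rw [show (2 * π * Complex.I * ((j + 1 : ℤ)) * x : ℂ) =
      ((2 * π * (j + 1) * x : ℝ) : ℂ) * Complex.I by push_cast; ring]
    rw [Complex.exp_ofReal_mul_I_re]
    have hN' : (0:ℝ) < N := by exact_mod_cast hN
    have h1 : (j + 1) * x ≤ 1 / 8 := by
      calc (j + 1) * x ≤ N * (1 / (8 * N)) := mul_le_mul hj' hx.2 hx.1.le hN'.le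
        _ = 1 / 8 := by field_simp
    have h0 : 0 ≤ (j + 1) * x := mul_nonneg (by positivity) hx.1.le
    have h2 : 2 * π * (j + 1) * x ≤ 1 := by
      nlinarith [Real.pi_lt_four, Real.pi_pos]
    have h3 : 0 ≤ 2 * π * (j + 1) * x := by
      nlinarith [Real.pi_pos]
    have := Real.one_sub_sq_div_two_le_cos (x := 2 * π * (j + 1) * x)
    nlinarith
  calc (N:ℝ) / 2 = ∑ j ∈ Finset.range N, (1:ℝ) / 2 := by simp; ring
    _ ≤ _ := Finset.sum_le_sum this

lemma dirichlet_Lp {p : ℝ} (hp : 1 < p) {N : ℕ} (hN : 0 < N) :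
    (1 / 16 : ℝ) * (N : ℝ) ^ (1 - 1 / p) ≤
      LpNorm01 p (fun x => ∑ j ∈ Finset.range N, e2 (j + 1) x) := by
  have hN' : (0:ℝ) < N := by exact_mod_cast hN
  have hN1 : (1:ℝ) ≤ N := by exact_mod_cast hN
  have hcD : Continuous fun x => ∑ j ∈ Finset.range N, e2 (j + 1) x :=
    continuous_finsetSum _ fun j _ => e2_cont _
  have hc : Continuous fun x => ‖∑ j ∈ Finset.range N, e2 (j + 1) x‖ ^ p :=
    hcD.norm.rpow_const fun x => Or.inr (by linarith)
  have hsub : Ioc (0:ℝ) (1 / (8 * N)) ⊆ Ioc 0 1 := by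
    refine Ioc_subset_Ioc_right ?_
    rw [div_le_one (by positivity)]; linarith
  have key : (1 / (8 * N)) * ((N:ℝ) / 2) ^ p ≤
      ∫ x in Ioc (0:ℝ) 1, ‖∑ j ∈ Finset.range N, e2 (j + 1) x‖ ^ p := by
    calc (1 / (8 * N)) * ((N:ℝ) / 2) ^ p = ∫ x in Ioc (0:ℝ) (1 / (8 * N)), ((N:ℝ) / 2) ^ p := by
          rw [setIntegral_const, Real.volume_real_Ioc_of_le (by positivity), smul_eq_mul, sub_zero]
      _ ≤ ∫ x in Ioc (0:ℝ) (1 / (8 * N)), ‖∑ j ∈ Finset.range N, e2 (j + 1) x‖ ^ p := by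
          refine setIntegral_mono_on ?_ ?_ measurableSet_Ioc fun x hx => ?_
          · exact (continuous_const.integrableOn_Ioc)
          · exact hc.integrableOn_Ioc
          · exact Real.rpow_le_rpow (by positivity) (dirichlet_big hN hx) (by linarith)
      _ ≤ _ := setIntegral_mono_set (cont_int hc)
          (Eventually.of_forall fun x => by positivity) hsub.eventuallyLE
  unfold LpNorm01
  refine le_trans ?_ (Real.rpow_le_rpow (by positivity) key (by positivity))
  rw [Real.mul_rpow (by positivity) (by positivity), ← Real.rpow_mul (by positivity),
    mul_one_div_cancel (by linarith), Real.rpow_one, Real.rpow_sub hN', Real.rpow_one,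
    one_div (8 * (N:ℝ)), Real.inv_rpow (by positivity), Real.mul_rpow (by positivity) hN'.le]
  have h8 : (8:ℝ) ^ (1 / p) ≤ 8 := by
    calc (8:ℝ) ^ (1 / p) ≤ 8 ^ (1:ℝ) := Real.rpow_le_rpow_of_exponent_le (by norm_num)
          (by rw [div_le_one (by linarith)]; exact hp.le)
      _ = 8 := Real.rpow_one _
  have h80 : (0:ℝ) < 8 ^ (1 / p) := by positivity
  have hNp : (0:ℝ) < (N:ℝ) ^ (1 / p) := by positivity
  calc 1 / 16 * ((N:ℝ) / N ^ (1 / p)) = (8 * (N:ℝ) ^ (1 / p))⁻¹ * (N / 2) := by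
        field_simp; norm_num
    _ ≤ _ := by gcongr

lemma dirichlet_L2 (N : ℕ) :
    ∫ x in Ioc (0:ℝ) 1, ‖∑ j ∈ Finset.range N, e2 (j + 1) x‖ ^ 2 = N := by
  have h : ∀ x, ((‖∑ j ∈ Finset.range N, e2 (j + 1) x‖ ^ 2 : ℝ) : ℂ) =
      ∑ j ∈ Finset.range N, ∑ l ∈ Finset.range N, e2 ((j:ℤ) - l) x := by
    intro x
    push_cast
    rw [← Complex.mul_conj', map_sum, Finset.sum_mul_sum]
    refine Finset.sum_congr rfl fun j _ => Finset.sum_congr rfl fun l _ => ?_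
    rw [e2_conj, ← e2_add]; congr 1; ring
  have h2 : ((∫ x in Ioc (0:ℝ) 1, ‖∑ j ∈ Finset.range N, e2 (j + 1) x‖ ^ 2 : ℝ) : ℂ) = N := by
    rw [← integral_complex_ofReal]
    simp_rw [h]
    rw [integral_finsetSum _ (f := fun (j : ℕ) x => ∑ l ∈ Finset.range N, e2 ((j:ℤ) - l) x)
      fun j _ => cont_int (continuous_finsetSum _ fun l _ => e2_cont _)]
    have : ∀ j ∈ Finset.range N,
        ∫ x in Ioc (0:ℝ) 1, ∑ l ∈ Finset.range N, e2 ((j:ℤ) - l) x = 1 := by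
      intro j hj
      rw [integral_finsetSum _ (f := fun (l : ℕ) x => e2 ((j:ℤ) - l) x)
        fun l _ => cont_int (e2_cont _)]
      simp_rw [e2_integral, sub_eq_zero, Nat.cast_inj]
      rw [Finset.sum_ite_eq, if_pos hj]
    rw [Finset.sum_congr rfl this]; simp
  exact_mod_cast h2

lemma dirichlet_le (N : ℕ) (x : ℝ) : ‖∑ j ∈ Finset.range N, e2 (j + 1) x‖ ≤ N := by
  refine (norm_sum_le _ _).trans ?_
  simp [e2_norm]

/-- The (modulated) Fejér kernel. -/
lemma fejer_norm (N : ℕ) (x : ℝ) :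
    ‖∑ q ∈ Finset.range N ×ˢ Finset.range N, e2 ((q.1:ℤ) + q.2 + 1) x‖ =
      ‖∑ j ∈ Finset.range N, e2 (j + 1) x‖ ^ 2 := by
  have : ∑ q ∈ Finset.range N ×ˢ Finset.range N, e2 ((q.1:ℤ) + q.2 + 1) x =
      e2 (-1) x * (∑ j ∈ Finset.range N, e2 (j + 1) x) ^ 2 := by
    rw [pow_two, Finset.sum_mul_sum, Finset.sum_product, Finset.mul_sum]
    refine Finset.sum_congr rfl fun j _ => ?_
    rw [Finset.mul_sum]
    refine Finset.sum_congr rfl fun l _ => ?_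
    rw [← e2_add, ← e2_add]; congr 1; ring
  rw [this, norm_mul, e2_norm, one_mul, norm_pow]

lemma fejer_Lp {p : ℝ} (hp : 1 < p) {N : ℕ} (hN : 0 < N) :
    LpNorm01 p (fun x => ∑ q ∈ Finset.range N ×ˢ Finset.range N, e2 ((q.1:ℤ) + q.2 + 1) x) ≤
      (N : ℝ) ^ (2 - 1 / p) := by
  have hN' : (0:ℝ) < N := by exact_mod_cast hN
  have hcD : Continuous fun x => ∑ j ∈ Finset.range N, e2 (j + 1) x :=
    continuous_finsetSum _ fun j _ => e2_cont _
  unfold LpNorm01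
  simp_rw [fejer_norm]
  have hc : Continuous fun x => (‖∑ j ∈ Finset.range N, e2 (j + 1) x‖ ^ 2) ^ p :=
    (hcD.norm.pow 2).rpow_const fun x => Or.inr (by linarith)
  have key : ∫ x in Ioc (0:ℝ) 1, (‖∑ j ∈ Finset.range N, e2 (j + 1) x‖ ^ 2) ^ p ≤
      (N:ℝ) ^ (2 * p - 1) := by
    calc _ ≤ ∫ x in Ioc (0:ℝ) 1, ((N:ℝ) ^ 2) ^ (p - 1) *
              ‖∑ j ∈ Finset.range N, e2 (j + 1) x‖ ^ 2 := by
          refine integral_mono (cont_int hc) (cont_int (continuous_const.mul (hcD.norm.pow 2)))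
            fun x => ?_
          dsimp only
          set t := ‖∑ j ∈ Finset.range N, e2 (j + 1) x‖ with ht
          have ht0 : 0 ≤ t := norm_nonneg _
          have htN : t ≤ N := dirichlet_le N x
          calc (t ^ 2) ^ p = (t ^ 2) ^ ((p - 1) + 1) := by rw [sub_add_cancel]
            _ = (t ^ 2) ^ (p - 1) * t ^ 2 := by
              rw [Real.rpow_add_one' (by positivity) (by linarith)]
            _ ≤ _ := by
              refine mul_le_mul_of_nonneg_right ?_ (by positivity)
              exact Real.rpow_le_rpow (by positivity) (by gcongr) (by linarith)
      _ = ((N:ℝ) ^ 2) ^ (p - 1) * N := by rw [integral_const_mul, dirichlet_L2]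
      _ = (N:ℝ) ^ (2 * p - 1) := by
          rw [← Real.rpow_natCast, ← Real.rpow_mul hN'.le, ← Real.rpow_add_one hN'.ne']
          congr 1; push_cast; ring
  refine (Real.rpow_le_rpow (integral_nonneg fun x => by positivity) key (by positivity)).trans ?_
  rw [← Real.rpow_mul hN'.le]
  apply le_of_eq; congr 1
  have : p ≠ 0 := by linarith
  field_simp

lemma card_antidiag {N i : ℕ} (hi : i < N) :
    (∑ q ∈ Finset.range N ×ˢ Finset.range N,
      Finsupp.single ((q.1:ℤ) + q.2 + 1) (1:ℂ)) ((i:ℤ) + 1) = i + 1 := by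
  rw [Finsupp.finsetSum_apply, Finset.sum_product]
  have : ∀ j ∈ Finset.range N, ∑ l ∈ Finset.range N,
      (Finsupp.single ((j:ℤ) + l + 1) (1:ℂ)) ((i:ℤ) + 1) = if j ∈ Finset.range (i + 1) then 1 else 0 := by
    intro j hj
    simp_rw [Finsupp.single_apply]
    split_ifs with h
    · have hji : j ≤ i := by simpa [Nat.lt_succ_iff] using h
      rw [Finset.sum_eq_single (i - j)]
      · rw [if_pos (by omega)]
      · intro b _ hb; rw [if_neg (by omega)]
      · intro hh; exact absurd (Finset.mem_range.2 (by omega)) hh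
    · have hji : ¬ j < i + 1 := by simpa using h
      refine Finset.sum_eq_zero fun l _ => ?_
      rw [if_neg (by omega)]
  rw [Finset.sum_congr rfl this, Finset.sum_ite_mem,
    Finset.inter_eq_right.2 (Finset.range_subset_range.2 (by omega))]
  simp

lemma sum_succ_ge (N : ℕ) : (N:ℝ) ^ 2 / 2 ≤ ∑ i ∈ Finset.range N, ((i:ℝ) + 1) := by
  induction N with
  | zero => simp
  | succ n ih => rw [Finset.sum_range_succ]; push_cast; nlinarith

lemma sqrt_two_le : √2 ≤ 2 := by
  rw [Real.sqrt_le_left (by norm_num)]; norm_num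

lemma sqrt_bound {N : ℕ} : √(2 * (N:ℝ)) ≤ 2 * (N:ℝ) ^ (1 / 2 : ℝ) := by
  rw [Real.sqrt_mul (by norm_num), ← Real.sqrt_eq_rpow]
  exact mul_le_mul_of_nonneg_right sqrt_two_le (by positivity)

lemma lower_aux {p : ℝ} (hp : 1 < p) {n N : ℕ} (hN : 0 < N)
    (a : ℤ → ℂ) (ha : ∀ m, ‖a m‖ ≤ 1)
    (ha0 : ∀ m, ¬ (1 ≤ m ∧ m ≤ (n : ℤ)) → a m = 0) (ε : ℕ → ℝ)
    (hε : ∀ j, ε j = 1 ∨ ε j = -1) (haε : ∀ j < N, a ((j:ℤ) + 1) = ε j)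
    (hP : ∀ x, ‖∑ j ∈ Finset.range N, (ε j : ℂ) * e2 (j + 1) x‖ ≤ √(2 * N)) :
    (1 / 32 : ℝ) * (N:ℝ) ^ |1 / 2 - 1 / p| ≤ multNormT p a := by
  have hN' : (0:ℝ) < N := by exact_mod_cast hN
  have hεε : ∀ j, (ε j : ℂ) * ε j = 1 := fun j => by rcases hε j with h | h <;> simp [h]
  rcases le_total 0 (1 / 2 - 1 / p) with hs | hs
  · rw [abs_of_nonneg hs]
    refine mult_lower hp n a ha ha0
      (∑ j ∈ Finset.range N, Finsupp.single ((j:ℤ) + 1) (ε j : ℂ))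
      (A := 2 * (N:ℝ) ^ (1 / 2 : ℝ)) (by positivity) ?_ ?_
    · simp_rw [poly_single']
      exact Lp_le_sup hp (continuous_finsetSum _ fun j _ => continuous_const.mul (e2_cont _))
        (by positivity) fun x => (hP x).trans sqrt_bound
    · simp_rw [poly_single]
      have : ∀ x, ∑ j ∈ Finset.range N, a ((j:ℤ) + 1) * (ε j : ℂ) * e2 ((j:ℤ) + 1) x =
          ∑ j ∈ Finset.range N, e2 ((j:ℤ) + 1) x := fun x =>
        Finset.sum_congr rfl fun j hj => by
          rw [haε j (Finset.mem_range.1 hj), hεε, one_mul]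
      simp_rw [this]
      refine le_trans (le_of_eq ?_) (dirichlet_Lp hp hN)
      rw [show (1 - 1 / p) = (1 / 2 - 1 / p) + 1 / 2 by ring, Real.rpow_add hN']
      ring
  · rw [abs_of_nonpos hs]
    set c : ℤ →₀ ℂ := ∑ q ∈ Finset.range N ×ˢ Finset.range N,
      Finsupp.single ((q.1:ℤ) + q.2 + 1) (1:ℂ) with hc
    refine mult_lower hp n a ha ha0 c (A := (N:ℝ) ^ (2 - 1 / p)) (by positivity) ?_ ?_
    · rw [hc]
      simp_rw [poly_single', one_mul]
      exact fejer_Lp hp hN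
    · set F : ℝ → ℂ := fun x => ∑ m ∈ c.support, a m * c m * e2 m x with hF
      have hFc : Continuous F := poly_cont c.support fun m => a m * c m
      refine le_trans ?_ (L1_le_Lp hp hFc)
      have hI : ∫ x in Ioc (0:ℝ) 1, F x * ∑ i ∈ Finset.range N, (ε i : ℂ) * e2 (-((i:ℤ) + 1)) x
          = ((∑ i ∈ Finset.range N, ((i:ℝ) + 1) : ℝ) : ℂ) := by
        simp_rw [Finset.mul_sum]
        rw [integral_finsetSum _
          (f := fun (i : ℕ) x => F x * ((ε i : ℂ) * e2 (-((i:ℤ) + 1)) x))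
          fun i _ => cont_int (hFc.mul (continuous_const.mul (e2_cont _)))]
        push_cast
        refine Finset.sum_congr rfl fun i hi => ?_
        have hiN := Finset.mem_range.1 hi
        have h1 : ∀ x, F x * ((ε i : ℂ) * e2 (-((i:ℤ) + 1)) x) =
          (ε i : ℂ) * ((∑ m ∈ c.support, a m * c m * e2 m x) * e2 (-((i:ℤ) + 1)) x) :=
          fun x => by rw [hF]; ring
        simp_rw [h1]
        rw [integral_const_mul, coef_integral c.support (fun m => a m * c m)]
        have h2 : c ((i:ℤ) + 1) = i + 1 := card_antidiag hiN
        rw [if_pos, haε i hiN, h2, ← mul_assoc, hεε, one_mul]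
        rw [Finsupp.mem_support_iff, h2]
        exact_mod_cast Nat.succ_ne_zero i
      have hPn : ∀ x, ‖∑ i ∈ Finset.range N, (ε i : ℂ) * e2 (-((i:ℤ) + 1)) x‖ ≤ √(2 * N) := by
        intro x
        refine le_trans (le_of_eq ?_) (hP x)
        rw [← Complex.norm_conj, map_sum]
        congr 1
        refine Finset.sum_congr rfl fun i _ => ?_
        rw [map_mul, e2_conj, neg_neg, Complex.conj_ofReal]
      have h3 : (N:ℝ) ^ 2 / 2 ≤ (∫ x in Ioc (0:ℝ) 1, ‖F x‖) * (2 * (N:ℝ) ^ (1 / 2 : ℝ)) := by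
        calc (N:ℝ) ^ 2 / 2 ≤ ∑ i ∈ Finset.range N, ((i:ℝ) + 1) := sum_succ_ge N
          _ = ‖((∑ i ∈ Finset.range N, ((i:ℝ) + 1) : ℝ) : ℂ)‖ := by
            rw [Complex.norm_real, Real.norm_of_nonneg (Finset.sum_nonneg fun i _ => by positivity)]
          _ ≤ ∫ x in Ioc (0:ℝ) 1,
              ‖F x * ∑ i ∈ Finset.range N, (ε i : ℂ) * e2 (-((i:ℤ) + 1)) x‖ := by
            rw [← hI]; exact norm_integral_le_integral_norm _
          _ ≤ ∫ x in Ioc (0:ℝ) 1, ‖F x‖ * (2 * (N:ℝ) ^ (1 / 2 : ℝ)) := by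
            refine integral_mono (cont_int ?_) (cont_int (hFc.norm.mul continuous_const)) fun x => ?_
            · exact (hFc.mul (continuous_finsetSum _ fun i _ =>
                continuous_const.mul (e2_cont _))).norm
            · dsimp only
              rw [norm_mul]
              exact mul_le_mul_of_nonneg_left ((hPn x).trans sqrt_bound) (norm_nonneg _)
          _ = _ := integral_mul_const _ _
      have hh : (0:ℝ) < (N:ℝ) ^ (1 / 2 : ℝ) := by positivity
      refine le_of_mul_le_mul_right (le_trans ?_ h3) (by positivity : 0 < 2 * (N:ℝ) ^ (1 / 2 : ℝ))
      have h4 : (N:ℝ) ^ (-(1 / 2 - 1 / p)) * (N:ℝ) ^ (2 - 1 / p) * (N:ℝ) ^ (1 / 2 : ℝ) = N ^ 2 := by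
        rw [← Real.rpow_add hN', ← Real.rpow_add hN', ← Real.rpow_natCast]
        congr 1; push_cast; ring
      have h5 : (0:ℝ) < (N:ℝ) ^ 2 := by positivity
      nlinarith

/-- For `1 < p < ∞`, `p ≠ 2`, there is `c_p > 0` such that for every `n`
there are signs `ε_k ∈ {-1,1}`, `1 ≤ k ≤ n`, with
`‖(…,0,ε_1,…,ε_n,0,…)‖_{M^p(𝕋)} ≥ c_p n^{|1/2-1/p|}`. -/
theorem multiplier_norm_lower_bound (p : ℝ) (hp1 : 1 < p) (hp2 : p ≠ 2) :
    ∃ c : ℝ, 0 < c ∧ ∀ n : ℕ, ∃ ε : ℕ → ℝ,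
      (∀ k ∈ Finset.Icc 1 n, ε k = 1 ∨ ε k = -1) ∧
      c * (n : ℝ) ^ |1/2 - 1/p| ≤
        multNormT p (fun m => if 1 ≤ m ∧ m ≤ (n : ℤ) then (ε m.toNat : ℂ) else 0) := by
  refine ⟨1 / 64, by norm_num, fun n => ?_⟩
  have hs0 : 0 < |1 / 2 - 1 / p| := by
    rw [abs_pos, sub_ne_zero]
    intro h
    apply hp2
    have : p ≠ 0 := by linarith
    field_simp at h
    linarith
  have hs1 : |1 / 2 - 1 / p| ≤ 1 := by
    have h1 : 0 < 1 / p := by positivity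
    have h2 : 1 / p ≤ 1 := by rw [div_le_one (by linarith)]; exact hp1.le
    rw [abs_le]; constructor <;> linarith
  rcases Nat.eq_zero_or_pos n with rfl | hn
  · refine ⟨fun _ => 1, by simp, ?_⟩
    rw [Nat.cast_zero, Real.zero_rpow hs0.ne', mul_zero]
    exact Real.sInf_nonneg fun C hC => hC.1
  · obtain ⟨ε, δ, hε, -, hRS⟩ := rudin_shapiro (Nat.log 2 n)
    have hle : 2 ^ Nat.log 2 n ≤ n := Nat.pow_log_le_self 2 hn.ne'
    have hlt : n < 2 ^ Nat.log 2 n * 2 := by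
      rw [← pow_succ]; exact Nat.lt_pow_succ_log_self (by norm_num) n
    have hN0 : 0 < 2 ^ Nat.log 2 n := by positivity
    have hRS' : ∀ x, ‖∑ j ∈ Finset.range (2 ^ Nat.log 2 n), (ε j : ℂ) * e2 (j + 1) x‖ ≤
        √(2 * ((2 ^ Nat.log 2 n : ℕ) : ℝ)) := by
      intro x
      apply Real.le_sqrt_of_sq_le
      have := hRS x
      push_cast
      nlinarith [sq_nonneg ‖∑ j ∈ Finset.range (2 ^ Nat.log 2 n), (δ j : ℂ) * e2 (j + 1) x‖]
    generalize 2 ^ Nat.log 2 n = N at *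
    refine ⟨fun k => ε (k - 1), fun k _ => hε _, ?_⟩
    refine le_trans ?_ (lower_aux hp1 (n := n) hN0 _ ?_ ?_ ε hε ?_ hRS')
    · have hnN : (n:ℝ) ≤ 2 * N := by
        have : n ≤ 2 * N := by omega
        exact_mod_cast this
      have h2 : (2:ℝ) ^ |1 / 2 - 1 / p| ≤ 2 := by
        calc (2:ℝ) ^ |1 / 2 - 1 / p| ≤ 2 ^ (1:ℝ) :=
              Real.rpow_le_rpow_of_exponent_le (by norm_num) hs1
          _ = 2 := Real.rpow_one _
      have h3 : (n:ℝ) ^ |1 / 2 - 1 / p| ≤ 2 * (N:ℝ) ^ |1 / 2 - 1 / p| := by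
        calc (n:ℝ) ^ |1 / 2 - 1 / p| ≤ (2 * (N:ℝ)) ^ |1 / 2 - 1 / p| :=
              Real.rpow_le_rpow (by positivity) hnN hs0.le
          _ = 2 ^ |1 / 2 - 1 / p| * (N:ℝ) ^ |1 / 2 - 1 / p| :=
              Real.mul_rpow (by norm_num) (by positivity)
          _ ≤ _ := mul_le_mul_of_nonneg_right h2 (by positivity)
      linarith
    · intro m
      dsimp only
      split_ifs
      · rcases hε (m.toNat - 1) with h | h <;> simp [h]
      · simp
    · intro m hm
      exact if_neg hm
    · intro j hj
      dsimp only
      rw [if_pos (by omega)]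
      congr 2
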